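/- arXiv:2403.12107 — 8 statements merged into one kernel-verified Lean document; each statement's English description precedes it below -/
import Mathlib

section
/- (Factor price frontier) Fix Φ ∈ (0,1) and define, for R ∈ (0,A], the wage w(R) = ((A^(1−σ) − R^(1−σ)·Φ)/(1−Φ))^(1/(1−σ)). Then: (i) for every R ∈ (0,A], the unit-cost identity (1/A)·(R^(1−σ)·Φ + w(R)^(1−σ)·(1−Φ))^(1/(1−σ)) = 1 holds; (ii) w is strictly decreasing on (0,A]; (iii) w(A) = A; (iv) the limit of w(R) as R → 0⁺ equals A·(1−Φ)^(1/(σ−1)). -/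
/-- Factor price frontier wage as a function of the rental rate `R`:
`w(R) = ((A^(1−σ) − R^(1−σ)·Φ)/(1−Φ))^(1/(1−σ))`. -/
noncomputable def wFPF (A σ Φ R : ℝ) : ℝ :=
  ((A ^ (1 - σ) - R ^ (1 - σ) * Φ) / (1 - Φ)) ^ (1 / (1 - σ))

/-- For a rental rate `R ∈ (0, A]` the base of the power defining the wage is positive. -/
lemma wFPF_base_pos {A σ Φ R : ℝ} (hσ1 : σ < 1) (hΦ1 : Φ < 1)
    (hR : R ∈ Set.Ioc (0 : ℝ) A) :
    0 < (A ^ (1 - σ) - R ^ (1 - σ) * Φ) / (1 - Φ) := by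
  have hle : R ^ (1 - σ) ≤ A ^ (1 - σ) :=
    Real.rpow_le_rpow hR.1.le hR.2 (sub_pos.2 hσ1).le
  have hpos : 0 < R ^ (1 - σ) := Real.rpow_pos_of_pos hR.1 _
  exact div_pos (by nlinarith) (sub_pos.2 hΦ1)

theorem stmt3 (A σ Φ : ℝ) (hA : 0 < A) (hσ0 : 0 < σ) (hσ1 : σ < 1)
    (hΦ0 : 0 < Φ) (hΦ1 : Φ < 1) :
    -- (i) unit-cost identity on (0, A]
    (∀ R ∈ Set.Ioc (0 : ℝ) A,
      (1 / A) * (R ^ (1 - σ) * Φ + (wFPF A σ Φ R) ^ (1 - σ) * (1 - Φ)) ^ (1 / (1 - σ)) = 1)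
    -- (ii) w is strictly decreasing on (0, A]
    ∧ StrictAntiOn (wFPF A σ Φ) (Set.Ioc (0 : ℝ) A)
    -- (iii) w(A) = A
    ∧ wFPF A σ Φ A = A
    -- (iv) limit as R → 0⁺
    ∧ Filter.Tendsto (wFPF A σ Φ) (nhdsWithin 0 (Set.Ioi 0))
        (nhds (A * (1 - Φ) ^ (1 / (σ - 1)))) := by
  have hs : 0 < 1 - σ := sub_pos.2 hσ1
  have hΦ : 0 < 1 - Φ := sub_pos.2 hΦ1
  have hA_rpow : (A ^ (1 - σ)) ^ (1 / (1 - σ)) = A := by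
    rw [one_div, Real.rpow_rpow_inv hA.le hs.ne']
  refine ⟨fun R hR => ?_, fun R hR S hS hRS => ?_, ?_, ?_⟩
  · rw [wFPF, one_div (1 - σ),
      Real.rpow_inv_rpow (wFPF_base_pos hσ1 hΦ1 hR).le hs.ne', div_mul_cancel₀ _ hΦ.ne',
      add_sub_cancel, ← one_div, hA_rpow, one_div_mul_cancel hA.ne']
  · refine Real.rpow_lt_rpow (wFPF_base_pos hσ1 hΦ1 hS).le ?_ (one_div_pos.2 hs)
    have hlt : R ^ (1 - σ) < S ^ (1 - σ) := Real.rpow_lt_rpow hR.1.le hRS hs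
    gcongr
  · rw [wFPF, ← mul_one_sub, mul_div_cancel_right₀ _ hΦ.ne', hA_rpow]
  · have hlim : A * (1 - Φ) ^ (1 / (σ - 1)) = wFPF A σ Φ 0 := by
      rw [wFPF, Real.zero_rpow hs.ne', zero_mul, sub_zero,
        Real.div_rpow (Real.rpow_nonneg hA.le _) hΦ.le, hA_rpow, ← neg_sub 1 σ,
        one_div_neg_eq_neg_one_div,
        Real.rpow_neg hΦ.le, ← div_eq_mul_inv]
    rw [hlim]
    have hcont : ContinuousAt (wFPF A σ Φ) 0 :=
      (((continuousAt_const.sub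
        ((Real.continuousAt_rpow_const 0 (1 - σ) (Or.inr hs.le)).mul continuousAt_const)).div_const
          (1 - Φ))).rpow_const (Or.inr (one_div_pos.2 hs).le)
    exact hcont.tendsto.mono_left nhdsWithin_le_nhds
end

section
/- (Automation swivels the factor price frontier) For fixed R ∈ (0,A), the FPF wage w(R;Φ) = ((A^(1−σ) − R^(1−σ)·Φ)/(1−Φ))^(1/(1−σ)) is strictly increasing in Φ on (0,1); in particular the limiting wage w*(Φ) = A·(1−Φ)^(1/(σ−1)) is strictly increasing in Φ on (0,1) and strictly increasing in A. For R = A, w(A;Φ) = A for every Φ ∈ (0,1). -/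
theorem stmt4 (A σ : ℝ) (hA : 0 < A) (hσ0 : 0 < σ) (hσ1 : σ < 1) :
    -- for fixed R ∈ (0,A), Φ ↦ w(R;Φ) is strictly increasing on (0,1)
    (∀ R ∈ Set.Ioo (0 : ℝ) A, StrictMonoOn (fun Φ => wFPF A σ Φ R) (Set.Ioo 0 1))
    -- the limiting wage w*(Φ) = A·(1−Φ)^(1/(σ−1)) is strictly increasing in Φ on (0,1)
    ∧ StrictMonoOn (fun Φ : ℝ => A * (1 - Φ) ^ (1 / (σ - 1))) (Set.Ioo 0 1)
    -- and strictly increasing in A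
    ∧ (∀ Φ ∈ Set.Ioo (0 : ℝ) 1,
        StrictMonoOn (fun A' : ℝ => A' * (1 - Φ) ^ (1 / (σ - 1))) (Set.Ioi 0))
    -- for R = A, w(A;Φ) = A for every Φ ∈ (0,1)
    ∧ (∀ Φ ∈ Set.Ioo (0 : ℝ) 1, wFPF A σ Φ A = A) := by
  have hs : 0 < 1 - σ := sub_pos.mpr hσ1
  refine ⟨?_, ?_, ?_, ?_⟩
  · rintro R ⟨hR0, hRA⟩ x ⟨hx0, hx1⟩ y ⟨hy0, hy1⟩ hxy
    have hRA' : R ^ (1 - σ) < A ^ (1 - σ) := Real.rpow_lt_rpow hR0.le hRA hs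
    have hR' : 0 < R ^ (1 - σ) := Real.rpow_pos_of_pos hR0 _
    have hx : 0 < 1 - x := sub_pos.mpr hx1
    have hy : 0 < 1 - y := sub_pos.mpr hy1
    refine Real.rpow_lt_rpow (div_nonneg ?_ hx.le) ?_ (one_div_pos.mpr hs)
    · nlinarith
    · rw [div_lt_div_iff₀ hx hy]
      nlinarith [mul_pos (sub_pos.mpr hRA') (sub_pos.mpr hxy)]
  · rintro x - y ⟨-, hy1⟩ hxy
    exact mul_lt_mul_of_pos_left
      (Real.rpow_lt_rpow_of_neg (sub_pos.mpr hy1) (sub_lt_sub_left hxy 1)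
        (one_div_neg.mpr (sub_neg.mpr hσ1))) hA
  · rintro Φ ⟨-, hΦ1⟩ a - b - hab
    exact mul_lt_mul_of_pos_right hab (Real.rpow_pos_of_pos (sub_pos.mpr hΦ1) _)
  · rintro Φ ⟨-, hΦ1⟩
    have hΦ : 1 - Φ ≠ 0 := (sub_pos.mpr hΦ1).ne'
    have hquot : (A ^ (1 - σ) - A ^ (1 - σ) * Φ) / (1 - Φ) = A ^ (1 - σ) := by
      field_simp
    rw [wFPF, hquot, one_div, Real.rpow_rpow_inv hA.le hs.ne']
end

section
/- (Automation and output) For every K > 0, L > 0 and Φ ∈ (0,1), with k = K/Φ and ℓ = L/(1−Φ), the partial derivative of F with respect to Φ satisfies ∂F/∂Φ = (1/(σ−1))·A^((σ−1)/σ)·F(K,L;Φ)^(1/σ)·(k^((σ−1)/σ) − ℓ^((σ−1)/σ)); in particular ∂F/∂Φ > 0 if and only if K/L > Φ/(1−Φ). -/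
/-- Region-1 CES production function. -/
noncomputable def F (A σ K L Φ : ℝ) : ℝ :=
  A * (K ^ ((σ - 1) / σ) * Φ ^ (1 / σ) + L ^ ((σ - 1) / σ) * (1 - Φ) ^ (1 / σ)) ^ (σ / (σ - 1))

/-- The inner CES aggregate is positive on the open unit interval. -/
lemma ces_aggregate_pos (a b : ℝ) {K L Φ : ℝ} (hK : 0 < K) (hL : 0 < L)
    (hΦ0 : 0 < Φ) (hΦ1 : Φ < 1) :
    0 < K ^ a * Φ ^ b + L ^ a * (1 - Φ) ^ b := by
  have : 0 < 1 - Φ := sub_pos.mpr hΦ1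
  positivity

/-- Derivative of the inner CES aggregate with respect to the automated fraction. -/
lemma hasDerivAt_ces_aggregate {σ K L Φ : ℝ} (hσ : σ ≠ 0) (hK : 0 < K) (hL : 0 < L)
    (hΦ0 : 0 < Φ) (hΦ1 : Φ < 1) :
    HasDerivAt (fun x => K ^ ((σ - 1) / σ) * x ^ (1 / σ) + L ^ ((σ - 1) / σ) * (1 - x) ^ (1 / σ))
      (1 / σ * ((K / Φ) ^ ((σ - 1) / σ) - (L / (1 - Φ)) ^ ((σ - 1) / σ))) Φ := by
  have h1 : 0 < 1 - Φ := sub_pos.mpr hΦ1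
  have hexp : 1 / σ - 1 = -((σ - 1) / σ) := by field_simp; ring
  have hΦ := (Real.hasDerivAt_rpow_const (p := 1 / σ) (Or.inl hΦ0.ne')).const_mul
    (K ^ ((σ - 1) / σ))
  have hc := (((hasDerivAt_id Φ).const_sub 1).rpow_const (p := 1 / σ) (Or.inl h1.ne')).const_mul
    (L ^ ((σ - 1) / σ))
  refine (hΦ.add hc).congr_deriv ?_
  simp only [id_eq]
  rw [hexp, Real.rpow_neg hΦ0.le, Real.rpow_neg h1.le, Real.div_rpow hK.le hΦ0.le,
    Real.div_rpow hL.le h1.le]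
  ring

theorem stmt6 (A σ K L Φ : ℝ) (hA : 0 < A) (hσ0 : 0 < σ) (hσ1 : σ < 1)
    (hK : 0 < K) (hL : 0 < L) (hΦ0 : 0 < Φ) (hΦ1 : Φ < 1) :
    HasDerivAt (fun Φ' => F A σ K L Φ')
      ((1 / (σ - 1)) * A ^ ((σ - 1) / σ) * (F A σ K L Φ) ^ (1 / σ)
        * ((K / Φ) ^ ((σ - 1) / σ) - (L / (1 - Φ)) ^ ((σ - 1) / σ))) Φ
    ∧ (0 < (1 / (σ - 1)) * A ^ ((σ - 1) / σ) * (F A σ K L Φ) ^ (1 / σ)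
        * ((K / Φ) ^ ((σ - 1) / σ) - (L / (1 - Φ)) ^ ((σ - 1) / σ))
      ↔ K / L > Φ / (1 - Φ)) := by
  have h1 : 0 < 1 - Φ := sub_pos.mpr hΦ1
  have hσ : σ - 1 < 0 := sub_neg.mpr hσ1
  have hσne : σ - 1 ≠ 0 := hσ.ne
  have hS := ces_aggregate_pos ((σ - 1) / σ) (1 / σ) hK hL hΦ0 hΦ1
  constructor
  · have hd := ((hasDerivAt_ces_aggregate hσ0.ne' hK hL hΦ0 hΦ1).rpow_const
      (p := σ / (σ - 1)) (Or.inl hS.ne')).const_mul A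
    refine hd.congr_deriv ?_
    have hexp : σ / (σ - 1) - 1 = σ / (σ - 1) * (1 / σ) := by field_simp; ring
    have hAA : A ^ ((σ - 1) / σ) * A ^ (1 / σ) = A := by
      rw [← Real.rpow_add hA, show (σ - 1) / σ + 1 / σ = 1 by field_simp; ring, Real.rpow_one]
    rw [F, Real.mul_rpow hA.le (Real.rpow_nonneg hS.le _), ← Real.rpow_mul hS.le, hexp]
    have hcoef : 1 / (σ - 1) = 1 / σ * (σ / (σ - 1)) := by field_simp
    nth_rewrite 1 [← hAA]
    rw [hcoef]
    ring
  · have hF : 0 < F A σ K L Φ := mul_pos hA (Real.rpow_pos_of_pos hS _)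
    have hneg : 1 / (σ - 1) * A ^ ((σ - 1) / σ) * F A σ K L Φ ^ (1 / σ) < 0 :=
      mul_neg_of_neg_of_pos (mul_neg_of_neg_of_pos (one_div_neg.mpr hσ)
        (Real.rpow_pos_of_pos hA _)) (Real.rpow_pos_of_pos hF _)
    rw [← neg_mul_neg, mul_pos_iff_of_pos_left (neg_pos.mpr hneg), neg_pos, sub_neg,
      Real.rpow_lt_rpow_iff_of_neg (div_pos hK hΦ0) (div_pos hL h1) (div_neg_of_neg_of_pos hσ hσ0),
      gt_iff_lt, div_lt_div_iff₀ h1 hΦ0, div_lt_div_iff₀ h1 hL, mul_comm L Φ]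
end

section
/- (Automation and wages are hump-shaped) Fix K > 0 and L > 0, and for Φ ∈ (0,1) let w(Φ) = F_L(K,L;Φ), k = K/Φ and ℓ = L/(1−Φ). Then: (i) the logarithmic derivative satisfies d(log w)/dΦ = (1/(σ(σ−1)))·(k^((σ−1)/σ) − ℓ^((σ−1)/σ))·(F(K,L;Φ)/A)^((1−σ)/σ) − 1/(σ·(1−Φ)); (ii) as Φ → 0⁺ this derivative tends to 1/(1−σ) > 0; (iii) as Φ → 1⁻ this derivative tends to −∞; (iv) there exists Φ* ∈ (0,1) such that w is strictly increasing in Φ on (0,Φ*) and strictly decreasing in Φ on (Φ*,1). -/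
/-- Wage: partial derivative of `F` with respect to `L`. -/
noncomputable def FL (A σ K L Φ : ℝ) : ℝ := deriv (fun L' => F A σ K L' Φ) L

/-- Logarithmic derivative of the wage with respect to the automated fraction `Φ`. -/
noncomputable def dlogw (A σ K L Φ : ℝ) : ℝ :=
  deriv (fun Φ' => Real.log (FL A σ K L Φ')) Φ

open Real Set Filter Topology

/-- The CES aggregate with inverse-elasticity parameter `p` and weights `a`, `b`. -/
noncomputable def cesAggregate (p a b Φ : ℝ) : ℝ :=
  a * Φ ^ (1 + p) + b * (1 - Φ) ^ (1 + p)

/-- Closed form of the logarithmic derivative of the wage in terms of `p = (1 - σ) / σ`. -/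
noncomputable def wageSlope (p a b Φ : ℝ) : ℝ :=
  -((1 + p) ^ 2 / p) * ((a * Φ ^ p - b * (1 - Φ) ^ p) / cesAggregate p a b Φ)
    - (1 + p) / (1 - Φ)

lemma cesAggregate_pos {p a b Φ : ℝ} (ha : 0 < a) (hb : 0 < b) (hΦ : Φ ∈ Ioo (0 : ℝ) 1) :
    0 < cesAggregate p a b Φ := by
  have h0 := hΦ.1
  have h1 : 0 < 1 - Φ := sub_pos.2 hΦ.2
  unfold cesAggregate
  positivity

lemma continuous_cesAggregate {p : ℝ} (hp : 0 < p) (a b : ℝ) :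
    Continuous (cesAggregate p a b) := by
  have hp' : 0 ≤ 1 + p := by positivity
  unfold cesAggregate
  exact (continuous_const.mul (continuous_id.rpow_const fun _ => Or.inr hp')).add
    (continuous_const.mul ((continuous_const.sub continuous_id).rpow_const fun _ => Or.inr hp'))

lemma continuous_marginal_cesAggregate {p : ℝ} (hp : 0 < p) (a b : ℝ) :
    Continuous fun Φ : ℝ => a * Φ ^ p - b * (1 - Φ) ^ p :=
  (continuous_const.mul (continuous_id.rpow_const fun _ => Or.inr hp.le)).sub
    (continuous_const.mul ((continuous_const.sub continuous_id).rpow_const fun _ => Or.inr hp.le))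

lemma hasDerivAt_cesAggregate {p : ℝ} (hp : 0 < p) (a b Φ : ℝ) :
    HasDerivAt (cesAggregate p a b) ((1 + p) * (a * Φ ^ p - b * (1 - Φ) ^ p)) Φ := by
  have h1 : (1 : ℝ) ≤ 1 + p := by linarith
  have hx := ((hasDerivAt_id Φ).rpow_const (p := 1 + p) (Or.inr h1)).const_mul a
  have hy := (((hasDerivAt_id Φ).const_sub 1).rpow_const (p := 1 + p) (Or.inr h1)).const_mul b
  refine (hx.add hy).congr_deriv ?_
  simp only [id, add_sub_cancel_left]
  ring

lemma F_eq_cesAggregate {p : ℝ} (hp : 0 < p) (A K L Φ : ℝ) :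
    F A (1 + p)⁻¹ K L Φ = A * cesAggregate p (K ^ (-p)) (L ^ (-p)) Φ ^ (-p⁻¹) := by
  have h1 : (1 + p) ≠ 0 := by positivity
  have e1 : ((1 + p)⁻¹ - 1) / (1 + p)⁻¹ = -p := by field_simp; ring
  have e2 : 1 / (1 + p)⁻¹ = 1 + p := by simp
  have e3 : (1 + p)⁻¹ / ((1 + p)⁻¹ - 1) = -p⁻¹ := by rw [← inv_div, e1, inv_neg]
  unfold F cesAggregate
  rw [e1, e2, e3]

lemma FL_eq {p A K L Φ : ℝ} (hp : 0 < p) (hK : 0 < K) (hL : 0 < L)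
    (hΦ : Φ ∈ Ioo (0 : ℝ) 1) :
    FL A (1 + p)⁻¹ K L Φ = A * L ^ (-p - 1) * (1 - Φ) ^ (1 + p) *
      cesAggregate p (K ^ (-p)) (L ^ (-p)) Φ ^ (-p⁻¹ - 1) := by
  have hS := cesAggregate_pos (p := p) (rpow_pos_of_pos hK (-p)) (rpow_pos_of_pos hL (-p)) hΦ
  have hin : HasDerivAt (fun L' => cesAggregate p (K ^ (-p)) (L' ^ (-p)) Φ)
      (-p * L ^ (-p - 1) * (1 - Φ) ^ (1 + p)) L :=
    ((hasDerivAt_rpow_const (Or.inl hL.ne')).mul_const _).const_add _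
  have h := (hin.rpow_const (p := -p⁻¹) (Or.inl hS.ne')).const_mul A
  simp only [FL, F_eq_cesAggregate hp]
  rw [h.deriv]
  field_simp

lemma FL_pos {p A K L Φ : ℝ} (hp : 0 < p) (hA : 0 < A) (hK : 0 < K) (hL : 0 < L)
    (hΦ : Φ ∈ Ioo (0 : ℝ) 1) : 0 < FL A (1 + p)⁻¹ K L Φ := by
  have hS := cesAggregate_pos (p := p) (rpow_pos_of_pos hK (-p)) (rpow_pos_of_pos hL (-p)) hΦ
  have h1 : 0 < 1 - Φ := sub_pos.2 hΦ.2
  rw [FL_eq hp hK hL hΦ]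
  positivity

lemma hasDerivAt_log_FL {p A K L Φ : ℝ} (hp : 0 < p) (hA : 0 < A) (hK : 0 < K) (hL : 0 < L)
    (hΦ : Φ ∈ Ioo (0 : ℝ) 1) :
    HasDerivAt (fun Φ' => log (FL A (1 + p)⁻¹ K L Φ'))
      (wageSlope p (K ^ (-p)) (L ^ (-p)) Φ) Φ := by
  have ha := rpow_pos_of_pos hK (-p)
  have hb := rpow_pos_of_pos hL (-p)
  have h1 : 0 < 1 - Φ := sub_pos.2 hΦ.2
  have hS := cesAggregate_pos (p := p) ha hb hΦ
  have hlog : (fun Φ' => log (FL A (1 + p)⁻¹ K L Φ')) =ᶠ[𝓝 Φ] fun Φ' =>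
      log (A * L ^ (-p - 1)) + (1 + p) * log (1 - Φ') +
        (-p⁻¹ - 1) * log (cesAggregate p (K ^ (-p)) (L ^ (-p)) Φ') := by
    filter_upwards [Ioo_mem_nhds hΦ.1 hΦ.2] with x hx
    have hx1 : 0 < 1 - x := sub_pos.2 hx.2
    have hSx := cesAggregate_pos (p := p) ha hb hx
    rw [FL_eq hp hK hL hx, log_mul (by positivity) (by positivity),
      log_mul (by positivity) (by positivity), log_rpow hx1, log_rpow hSx]
  have hy := ((((hasDerivAt_id Φ).const_sub 1).log h1.ne').const_mul (1 + p)).const_add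
    (log (A * L ^ (-p - 1)))
  have hz := ((hasDerivAt_cesAggregate hp (K ^ (-p)) (L ^ (-p)) Φ).log hS.ne').const_mul
    (-p⁻¹ - 1)
  refine ((hy.add hz).congr_of_eventuallyEq hlog).congr_deriv ?_
  simp only [wageSlope, id]
  field_simp
  ring

lemma dlogw_eq_wageSlope {p A K L Φ : ℝ} (hp : 0 < p) (hA : 0 < A) (hK : 0 < K) (hL : 0 < L)
    (hΦ : Φ ∈ Ioo (0 : ℝ) 1) :
    dlogw A (1 + p)⁻¹ K L Φ = wageSlope p (K ^ (-p)) (L ^ (-p)) Φ :=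
  (hasDerivAt_log_FL hp hA hK hL hΦ).deriv

lemma wageSlope_eq {p A K L Φ : ℝ} (hp : 0 < p) (hA : 0 < A) (hK : 0 < K) (hL : 0 < L)
    (hΦ : Φ ∈ Ioo (0 : ℝ) 1) :
    wageSlope p (K ^ (-p)) (L ^ (-p)) Φ
      = (1 / ((1 + p)⁻¹ * ((1 + p)⁻¹ - 1)))
          * ((K / Φ) ^ (((1 + p)⁻¹ - 1) / (1 + p)⁻¹)
            - (L / (1 - Φ)) ^ (((1 + p)⁻¹ - 1) / (1 + p)⁻¹))
          * (F A (1 + p)⁻¹ K L Φ / A) ^ ((1 - (1 + p)⁻¹) / (1 + p)⁻¹)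
        - 1 / ((1 + p)⁻¹ * (1 - Φ)) := by
  have hS := cesAggregate_pos (p := p) (rpow_pos_of_pos hK (-p)) (rpow_pos_of_pos hL (-p)) hΦ
  have h0 := hΦ.1
  have h1 : 0 < 1 - Φ := sub_pos.2 hΦ.2
  have hq : 1 + p ≠ 0 := by positivity
  have e1 : ((1 + p)⁻¹ - 1) / (1 + p)⁻¹ = -p := by field_simp; ring
  have e2 : (1 - (1 + p)⁻¹) / (1 + p)⁻¹ = p := by field_simp; ring
  have e3 : 1 / ((1 + p)⁻¹ * ((1 + p)⁻¹ - 1)) = -((1 + p) ^ 2 / p) := by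
    have : (1 + p)⁻¹ - 1 = -p / (1 + p) := by field_simp; ring
    rw [this]
    field_simp
  have e4 : 1 / ((1 + p)⁻¹ * (1 - Φ)) = (1 + p) / (1 - Φ) := by field_simp
  have e5 : (K / Φ) ^ (-p) = K ^ (-p) * Φ ^ p := by
    rw [div_rpow hK.le h0.le, rpow_neg h0.le, div_inv_eq_mul]
  have e6 : (L / (1 - Φ)) ^ (-p) = L ^ (-p) * (1 - Φ) ^ p := by
    rw [div_rpow hL.le h1.le, rpow_neg h1.le, div_inv_eq_mul]
  have e7 : (F A (1 + p)⁻¹ K L Φ / A) ^ p = (cesAggregate p (K ^ (-p)) (L ^ (-p)) Φ)⁻¹ := by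
    rw [F_eq_cesAggregate hp, mul_div_cancel_left₀ _ hA.ne', ← rpow_mul hS.le, neg_mul,
      inv_mul_cancel₀ hp.ne', rpow_neg_one]
  rw [e1, e2, e3, e4, e5, e6, e7, wageSlope, div_eq_mul_inv _ (cesAggregate _ _ _ _), mul_assoc]

lemma tendsto_wageSlope_zero {p b : ℝ} (hp : 0 < p) (a : ℝ) (hb : 0 < b) :
    Tendsto (wageSlope p a b) (𝓝 0) (𝓝 ((1 + p) / p)) := by
  have hS : cesAggregate p a b 0 = b := by
    simp [cesAggregate, zero_rpow (by positivity : 1 + p ≠ 0)]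
  have hcont : ContinuousAt (wageSlope p a b) 0 :=
    (continuousAt_const.mul ((continuous_marginal_cesAggregate hp a b).continuousAt.div
      (continuous_cesAggregate hp a b).continuousAt (by rw [hS]; exact hb.ne'))).sub
      (continuousAt_const.div (continuousAt_const.sub continuousAt_id) (by simp))
  have hval : wageSlope p a b 0 = (1 + p) / p := by
    simp only [wageSlope, hS, zero_rpow hp.ne', sub_zero, one_rpow]
    field_simp
    ring
  exact hval ▸ hcont.tendsto

lemma tendsto_wageSlope_one {p a : ℝ} (hp : 0 < p) (ha : 0 < a) (b : ℝ) :
    Tendsto (wageSlope p a b) (𝓝[<] 1) atBot := by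
  have hS : cesAggregate p a b 1 = a := by
    simp [cesAggregate, zero_rpow (by positivity : 1 + p ≠ 0)]
  have hcont : ContinuousAt (fun Φ => -((1 + p) ^ 2 / p) *
      ((a * Φ ^ p - b * (1 - Φ) ^ p) / cesAggregate p a b Φ)) 1 :=
    continuousAt_const.mul ((continuous_marginal_cesAggregate hp a b).continuousAt.div
      (continuous_cesAggregate hp a b).continuousAt (by rw [hS]; exact ha.ne'))
  have hgap : Tendsto (fun Φ : ℝ => 1 - Φ) (𝓝[<] 1) (𝓝[>] 0) := by
    refine tendsto_nhdsWithin_iff.2 ⟨?_, ?_⟩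
    · have : Tendsto (fun Φ : ℝ => 1 - Φ) (𝓝 1) (𝓝 (1 - 1)) :=
        (continuous_const.sub continuous_id).tendsto 1
      rw [sub_self] at this
      exact this.mono_left nhdsWithin_le_nhds
    · filter_upwards [self_mem_nhdsWithin] with x hx using sub_pos.2 (mem_Iio.1 hx)
  have htop : Tendsto (fun Φ : ℝ => (1 + p) / (1 - Φ)) (𝓝[<] 1) atTop := by
    simpa only [div_eq_mul_inv, Function.comp_def] using
      (tendsto_inv_nhdsGT_zero.comp hgap).const_mul_atTop (by positivity : 0 < 1 + p)
  refine ((hcont.tendsto.mono_left nhdsWithin_le_nhds).add_atBot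
    (tendsto_neg_atTop_atBot.comp htop)).congr fun Φ => ?_
  simp only [wageSlope, Function.comp_apply, sub_eq_add_neg]

/-- Up to the positive factor `(1 + p) (1 - Φ) ^ p / (p S)`, the slope of the log wage is
`b - a (Φ / (1 - Φ)) ^ p (1 + p / (1 - Φ))`. -/
lemma wageSlope_eq_mul {p a b Φ : ℝ} (hp : 0 < p) (ha : 0 < a) (hb : 0 < b)
    (hΦ : Φ ∈ Ioo (0 : ℝ) 1) :
    wageSlope p a b Φ = (1 + p) * (1 - Φ) ^ p / (p * cesAggregate p a b Φ) *
      (b - a * ((Φ / (1 - Φ)) ^ p * (1 + p / (1 - Φ)))) := by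
  have h0 := hΦ.1
  have h1 : 0 < 1 - Φ := sub_pos.2 hΦ.2
  have hS := cesAggregate_pos (p := p) ha hb hΦ
  have hSe : cesAggregate p a b Φ = a * (Φ * Φ ^ p) + b * ((1 - Φ) * (1 - Φ) ^ p) := by
    simp only [cesAggregate, rpow_add h0, rpow_add h1, rpow_one]
  have hy := rpow_pos_of_pos h1 p
  rw [wageSlope, div_rpow h0.le h1.le]
  field_simp
  rw [hSe]
  ring

lemma strictMonoOn_odds_rpow_mul {p : ℝ} (hp : 0 < p) :
    StrictMonoOn (fun Φ : ℝ => (Φ / (1 - Φ)) ^ p * (1 + p / (1 - Φ))) (Ioo 0 1) := by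
  intro x hx y hy hxy
  have hx0 := hx.1
  have hy0 := hy.1
  have hx1 : 0 < 1 - x := sub_pos.2 hx.2
  have hy1 : 0 < 1 - y := sub_pos.2 hy.2
  have h1 : x / (1 - x) < y / (1 - y) := by
    rw [div_lt_div_iff₀ hx1 hy1]
    linarith
  have h2 : p / (1 - x) < p / (1 - y) := div_lt_div_of_pos_left hp hy1 (by linarith)
  exact mul_lt_mul'' (rpow_lt_rpow (by positivity) h1 hp) (by linarith)
    (by positivity) (by positivity)

/-- The log-wage slope changes sign exactly once on `(0, 1)`, from positive to negative. -/
lemma exists_wageSlope_sign_change {p a b : ℝ} (hp : 0 < p) (ha : 0 < a) (hb : 0 < b) :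
    ∃ c ∈ Ioo (0 : ℝ) 1, (∀ x ∈ Ioo 0 c, 0 < wageSlope p a b x) ∧
      ∀ x ∈ Ioo c 1, wageSlope p a b x < 0 := by
  have hq : 1 + p ≠ 0 := by positivity
  have hcont : Continuous fun x : ℝ => b * (1 - x) ^ (1 + p) - a * (x ^ p * (1 + p - x)) :=
    (continuous_const.mul ((continuous_const.sub continuous_id).rpow_const
      fun _ => Or.inr (by positivity))).sub (continuous_const.mul
        ((continuous_id.rpow_const fun _ => Or.inr hp.le).mul (continuous_const.sub continuous_id)))
  obtain ⟨c, hc, hroot⟩ := intermediate_value_Ioo' zero_le_one hcont.continuousOn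
    (show (0 : ℝ) ∈ _ by
      simp only [mem_Ioo, sub_self, zero_rpow hq, zero_rpow hp.ne', sub_zero, one_rpow]
      constructor
      · have := mul_pos ha hp
        linarith
      · linarith)
  have hc0 := hc.1
  have hc1 : 0 < 1 - c := sub_pos.2 hc.2
  have hbal : b = a * ((c / (1 - c)) ^ p * (1 + p / (1 - c))) := by
    have hy := rpow_pos_of_pos hc1 p
    simp only [rpow_add hc1, rpow_one] at hroot
    rw [div_rpow hc0.le hc1.le]
    field_simp
    linarith
  have hfac : ∀ x ∈ Ioo (0 : ℝ) 1,
      0 < (1 + p) * (1 - x) ^ p / (p * cesAggregate p a b x) := fun x hx => by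
    have hS := cesAggregate_pos (p := p) ha hb hx
    have h1 : 0 < 1 - x := sub_pos.2 hx.2
    positivity
  refine ⟨c, hc, fun x hx => ?_, fun x hx => ?_⟩
  · have hx' : x ∈ Ioo (0 : ℝ) 1 := ⟨hx.1, hx.2.trans hc.2⟩
    have hlt := mul_lt_mul_of_pos_left (strictMonoOn_odds_rpow_mul hp hx' hc hx.2) ha
    rw [wageSlope_eq_mul hp ha hb hx']
    exact mul_pos (hfac x hx') (sub_pos.2 (hlt.trans_eq hbal.symm))
  · have hx' : x ∈ Ioo (0 : ℝ) 1 := ⟨hc.1.trans hx.1, hx.2⟩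
    have hlt := mul_lt_mul_of_pos_left (strictMonoOn_odds_rpow_mul hp hc hx' hx.1) ha
    rw [wageSlope_eq_mul hp ha hb hx']
    exact mul_neg_of_pos_of_neg (hfac x hx') (sub_neg.2 (hbal.trans_lt hlt))

theorem stmt8 (A σ K L : ℝ) (hA : 0 < A) (hσ0 : 0 < σ) (hσ1 : σ < 1)
    (hK : 0 < K) (hL : 0 < L) :
    -- (i) the logarithmic derivative formula, for every Φ ∈ (0,1)
    (∀ Φ ∈ Set.Ioo (0 : ℝ) 1,
      dlogw A σ K L Φ
        = (1 / (σ * (σ - 1)))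
            * ((K / Φ) ^ ((σ - 1) / σ) - (L / (1 - Φ)) ^ ((σ - 1) / σ))
            * (F A σ K L Φ / A) ^ ((1 - σ) / σ)
          - 1 / (σ * (1 - Φ)))
    -- (ii) as Φ → 0⁺ the derivative tends to 1/(1−σ) > 0
    ∧ Filter.Tendsto (fun Φ => dlogw A σ K L Φ) (nhdsWithin 0 (Set.Ioo 0 1))
        (nhds (1 / (1 - σ)))
    ∧ 0 < 1 / (1 - σ)
    -- (iii) as Φ → 1⁻ the derivative tends to −∞
    ∧ Filter.Tendsto (fun Φ => dlogw A σ K L Φ) (nhdsWithin 1 (Set.Ioo 0 1))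
        Filter.atBot
    -- (iv) wages are hump-shaped in Φ
    ∧ ∃ Φstar ∈ Set.Ioo (0 : ℝ) 1,
        StrictMonoOn (fun Φ => FL A σ K L Φ) (Set.Ioo 0 Φstar)
        ∧ StrictAntiOn (fun Φ => FL A σ K L Φ) (Set.Ioo Φstar 1) := by
  obtain ⟨p, hp, rfl⟩ : ∃ p : ℝ, 0 < p ∧ σ = (1 + p)⁻¹ :=
    ⟨σ⁻¹ - 1, sub_pos.2 ((one_lt_inv₀ hσ0).2 hσ1), by simp⟩
  have ha := rpow_pos_of_pos hK (-p)
  have hb := rpow_pos_of_pos hL (-p)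
  have hslope : ∀ {l : Filter ℝ}, Ioo (0 : ℝ) 1 ∈ l →
      wageSlope p (K ^ (-p)) (L ^ (-p)) =ᶠ[l] fun Φ => dlogw A (1 + p)⁻¹ K L Φ := fun hl => by
    filter_upwards [hl] with x hx using (dlogw_eq_wageSlope hp hA hK hL hx).symm
  refine ⟨fun Φ hΦ => ?_, ?_, one_div_pos.2 (sub_pos.2 hσ1), ?_, ?_⟩
  · rw [dlogw_eq_wageSlope hp hA hK hL hΦ, wageSlope_eq hp hA hK hL hΦ]
  · have hlim : 1 / (1 - (1 + p)⁻¹) = (1 + p) / p := by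
      have : 1 - (1 + p)⁻¹ = p / (1 + p) := by field_simp; ring
      rw [this, one_div_div]
    rw [hlim]
    exact ((tendsto_wageSlope_zero hp _ hb).mono_left nhdsWithin_le_nhds).congr'
      (hslope self_mem_nhdsWithin)
  · exact ((tendsto_wageSlope_one hp ha _).mono_left
      (nhdsWithin_mono 1 fun x hx => hx.2)).congr' (hslope self_mem_nhdsWithin)
  · obtain ⟨c, hc, hpos, hneg⟩ := exists_wageSlope_sign_change hp ha hb
    have hleft : Ioo 0 c ⊆ Ioo (0 : ℝ) 1 := Ioo_subset_Ioo_right hc.2.le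
    have hright : Ioo c 1 ⊆ Ioo (0 : ℝ) 1 := Ioo_subset_Ioo_left hc.1.le
    have hcont : ContinuousOn (fun Φ => log (FL A (1 + p)⁻¹ K L Φ)) (Ioo 0 1) := fun x hx =>
      (hasDerivAt_log_FL hp hA hK hL hx).continuousAt.continuousWithinAt
    refine ⟨c, hc, fun x hx y hy hxy => ?_, fun x hx y hy hxy => ?_⟩
    · refine (log_lt_log_iff (FL_pos hp hA hK hL (hleft hx)) (FL_pos hp hA hK hL (hleft hy))).1
        (strictMonoOn_of_deriv_pos (convex_Ioo 0 c) (hcont.mono hleft) (fun z hz => ?_) hx hy hxy)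
      rw [interior_Ioo] at hz
      rw [(hasDerivAt_log_FL hp hA hK hL (hleft hz)).deriv]
      exact hpos z hz
    · refine (log_lt_log_iff (FL_pos hp hA hK hL (hright hy)) (FL_pos hp hA hK hL (hright hx))).1
        (strictAntiOn_of_deriv_neg (convex_Ioo c 1) (hcont.mono hright) (fun z hz => ?_) hx hy hxy)
      rw [interior_Ioo] at hz
      rw [(hasDerivAt_log_FL hp hA hK hL (hright hz)).deriv]
      exact hneg z hz
end

section
/- (Optimal capital stock under incomplete automation) Fix L > 0, Φ ∈ (0,1) and R with 0 < R < A·Φ^(1/(σ−1)), equivalently R^(σ−1) > A^(σ−1)·Φ. Then K⁺ = A^σ·L·(1−Φ)^(1/(σ−1))·Φ / (R^(σ−1) − A^(σ−1)·Φ)^(σ/(σ−1)) is positive and is the unique K > 0 with F_K(K,L;Φ) = R; moreover K ↦ F_K(K,L;Φ) is strictly decreasing on (0,∞). -/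
/-- Return to capital: partial derivative of `F` with respect to `K`. -/
noncomputable def FK (A σ K L Φ : ℝ) : ℝ := deriv (fun K' => F A σ K' L Φ) K

open Real in
/-- Differentiating the CES aggregate and factoring the power of `K` into the bracket. -/
theorem FK_eq {A σ K L Φ : ℝ} (hσ0 : 0 < σ) (hσ1 : σ < 1)
    (hK : 0 < K) (hL : 0 < L) (hΦ0 : 0 < Φ) (hΦ1 : Φ < 1) :
    FK A σ K L Φ =
      A * (Φ + (1 - Φ) ^ (1 / σ) * (L * Φ / K) ^ ((σ - 1) / σ)) ^ (1 / (σ - 1)) := by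
  have hs : σ - 1 ≠ 0 := by linarith
  have hσ : σ ≠ 0 := hσ0.ne'
  have hΨ : 0 < 1 - Φ := by linarith
  set B := K ^ ((σ - 1) / σ) * Φ ^ (1 / σ) + L ^ ((σ - 1) / σ) * (1 - Φ) ^ (1 / σ) with hB
  have hBpos : 0 < B := by positivity
  have hderiv : FK A σ K L Φ = A * ((((σ - 1) / σ) * K ^ ((σ - 1) / σ - 1) * Φ ^ (1 / σ)) *
      (σ / (σ - 1)) * B ^ (σ / (σ - 1) - 1)) :=
    (((((hasDerivAt_rpow_const (p := (σ - 1) / σ) (Or.inl hK.ne')).mul_const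
      (Φ ^ (1 / σ))).add_const (L ^ ((σ - 1) / σ) * (1 - Φ) ^ (1 / σ))).rpow_const
      (p := σ / (σ - 1)) (Or.inl hBpos.ne')).const_mul A).deriv
  have hbracket : Φ + (1 - Φ) ^ (1 / σ) * (L * Φ / K) ^ ((σ - 1) / σ) =
      (Φ / K) ^ ((σ - 1) / σ) * B := by
    have hΦ : Φ ^ ((σ - 1) / σ) * Φ ^ (1 / σ) = Φ := by
      rw [← rpow_add hΦ0, ← add_div, sub_add_cancel, div_self hσ, rpow_one]
    have hKpos : 0 < K ^ ((σ - 1) / σ) := by positivity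
    rw [div_rpow (by positivity) hK.le, div_rpow hΦ0.le hK.le, mul_rpow hL.le hΦ0.le, hB]
    field_simp
    linear_combination (-K ^ ((σ - 1) / σ)) * hΦ
  have hpow : ((Φ / K) ^ ((σ - 1) / σ)) ^ (1 / (σ - 1)) =
      K ^ ((σ - 1) / σ - 1) * Φ ^ (1 / σ) := by
    rw [← rpow_mul (by positivity), show (σ - 1) / σ * (1 / (σ - 1)) = 1 / σ by field_simp,
      show (σ - 1) / σ - 1 = -(1 / σ) by field_simp; ring, div_rpow hΦ0.le hK.le, rpow_neg hK.le]
    ring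
  rw [hderiv, hbracket, mul_rpow (by positivity) hBpos.le, hpow,
    show σ / (σ - 1) - 1 = 1 / (σ - 1) by field_simp; ring]
  field_simp

open Real in
theorem FK_strictAntiOn {A σ L Φ : ℝ} (hA : 0 < A) (hσ0 : 0 < σ) (hσ1 : σ < 1)
    (hL : 0 < L) (hΦ0 : 0 < Φ) (hΦ1 : Φ < 1) :
    StrictAntiOn (fun K => FK A σ K L Φ) (Set.Ioi 0) := by
  intro x (hx : 0 < x) y (hy : 0 < y) hxy
  have hΨ : 0 < 1 - Φ := by linarith
  have hs : σ - 1 < 0 := by linarith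
  simp only [FK_eq hσ0 hσ1 hx hL hΦ0 hΦ1, FK_eq hσ0 hσ1 hy hL hΦ0 hΦ1]
  refine mul_lt_mul_of_pos_left (rpow_lt_rpow_of_neg (by positivity) ?_
    (one_div_neg.mpr hs)) hA
  have hratio : L * Φ / y < L * Φ / x := div_lt_div_of_pos_left (by positivity) hx hxy
  have := rpow_lt_rpow_of_neg (by positivity) hratio (div_neg_of_neg_of_pos hs hσ0)
  gcongr

open Real in
theorem lt_mul_rpow_one_div_iff {A σ Φ R : ℝ} (hA : 0 < A) (hσ1 : σ < 1) (hΦ0 : 0 < Φ)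
    (hR0 : 0 < R) : R < A * Φ ^ (1 / (σ - 1)) ↔ A ^ (σ - 1) * Φ < R ^ (σ - 1) := by
  have hs : σ - 1 < 0 := by linarith
  rw [← rpow_lt_rpow_iff_of_neg (by positivity) hR0 hs, mul_rpow hA.le (by positivity),
    ← rpow_mul hΦ0.le, one_div_mul_cancel hs.ne, rpow_one]

open Real in
theorem FK_optimalCapital {A σ L Φ R : ℝ} (hA : 0 < A) (hσ0 : 0 < σ) (hσ1 : σ < 1)
    (hL : 0 < L) (hΦ0 : 0 < Φ) (hΦ1 : Φ < 1) (hR0 : 0 < R)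
    (hR : A ^ (σ - 1) * Φ < R ^ (σ - 1)) :
    FK A σ (A ^ σ * L * (1 - Φ) ^ (1 / (σ - 1)) * Φ
      / (R ^ (σ - 1) - A ^ (σ - 1) * Φ) ^ (σ / (σ - 1))) L Φ = R := by
  have hs : σ - 1 ≠ 0 := by linarith
  have hσ : σ ≠ 0 := hσ0.ne'
  have hΨ : 0 < 1 - Φ := by linarith
  have hD : 0 < R ^ (σ - 1) - A ^ (σ - 1) * Φ := by linarith
  rw [FK_eq hσ0 hσ1 (by positivity) hL hΦ0 hΦ1]
  set D := R ^ (σ - 1) - A ^ (σ - 1) * Φ with hDdef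
  have hratio : L * Φ / (A ^ σ * L * (1 - Φ) ^ (1 / (σ - 1)) * Φ / D ^ (σ / (σ - 1))) =
      D ^ (σ / (σ - 1)) / (A ^ σ * (1 - Φ) ^ (1 / (σ - 1))) := by
    field_simp
  have hbracket : Φ + (1 - Φ) ^ (1 / σ) *
      (D ^ (σ / (σ - 1)) / (A ^ σ * (1 - Φ) ^ (1 / (σ - 1)))) ^ ((σ - 1) / σ) =
      (R / A) ^ (σ - 1) := by
    rw [div_rpow (by positivity) (by positivity), mul_rpow (by positivity) (by positivity),
      ← rpow_mul hD.le, ← rpow_mul hA.le, ← rpow_mul hΨ.le, div_rpow hR0.le hA.le,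
      show σ / (σ - 1) * ((σ - 1) / σ) = 1 by field_simp,
      show σ * ((σ - 1) / σ) = σ - 1 by field_simp,
      show 1 / (σ - 1) * ((σ - 1) / σ) = 1 / σ by field_simp, rpow_one]
    have hApos : 0 < A ^ (σ - 1) := by positivity
    have hΨpos : 0 < (1 - Φ) ^ (1 / σ) := by positivity
    generalize (1 - Φ) ^ (1 / σ) = w at *
    generalize A ^ (σ - 1) = a at *
    field_simp
    rw [hDdef]
    ring
  rw [hratio, hbracket, ← rpow_mul (by positivity), mul_one_div_cancel hs, rpow_one]
  field_simp

theorem stmt9 (A σ L Φ R : ℝ) (hA : 0 < A) (hσ0 : 0 < σ) (hσ1 : σ < 1)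
    (hL : 0 < L) (hΦ0 : 0 < Φ) (hΦ1 : Φ < 1)
    (hR0 : 0 < R) (hR : R < A * Φ ^ (1 / (σ - 1))) :
    -- the two forms of the condition on R are equivalent
    (R < A * Φ ^ (1 / (σ - 1)) ↔ R ^ (σ - 1) > A ^ (σ - 1) * Φ)
    -- K⁺ is positive and is the unique K > 0 with F_K(K,L;Φ) = R
    ∧ (0 < A ^ σ * L * (1 - Φ) ^ (1 / (σ - 1)) * Φ
          / (R ^ (σ - 1) - A ^ (σ - 1) * Φ) ^ (σ / (σ - 1)))
    ∧ FK A σ (A ^ σ * L * (1 - Φ) ^ (1 / (σ - 1)) * Φ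
          / (R ^ (σ - 1) - A ^ (σ - 1) * Φ) ^ (σ / (σ - 1))) L Φ = R
    ∧ (∀ K : ℝ, 0 < K → FK A σ K L Φ = R →
        K = A ^ σ * L * (1 - Φ) ^ (1 / (σ - 1)) * Φ
          / (R ^ (σ - 1) - A ^ (σ - 1) * Φ) ^ (σ / (σ - 1)))
    -- K ↦ F_K(K,L;Φ) is strictly decreasing on (0,∞)
    ∧ StrictAntiOn (fun K => FK A σ K L Φ) (Set.Ioi 0) := by
  have hcond := lt_mul_rpow_one_div_iff hA hσ1 hΦ0 hR0
  have hD : 0 < R ^ (σ - 1) - A ^ (σ - 1) * Φ := sub_pos.mpr (hcond.mp hR)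
  have hΨ : 0 < 1 - Φ := by linarith
  have hpos : 0 < A ^ σ * L * (1 - Φ) ^ (1 / (σ - 1)) * Φ
      / (R ^ (σ - 1) - A ^ (σ - 1) * Φ) ^ (σ / (σ - 1)) := by positivity
  have hopt := FK_optimalCapital hA hσ0 hσ1 hL hΦ0 hΦ1 hR0 (hcond.mp hR)
  have hanti := FK_strictAntiOn hA hσ0 hσ1 hL hΦ0 hΦ1
  exact ⟨hcond, hpos, hopt, fun K hK h => hanti.injOn hK hpos (h.trans hopt.symm), hanti⟩
end

section
/- (Output growth decomposition) Let K : ℝ → (0,∞) and Φ : ℝ → (0,1) be differentiable, fix L > 0, and set Y(t) = F(K(t),L;Φ(t)). Define the shares S_K(t) = K(t)^((σ−1)/σ)·Φ(t)^(1/σ) / (K(t)^((σ−1)/σ)·Φ(t)^(1/σ) + L^((σ−1)/σ)·(1−Φ(t))^(1/σ)) and S_L(t) = 1 − S_K(t). Then Y is differentiable and for every t, Y'(t)/Y(t) = S_K(t)·K'(t)/K(t) + (1/(1−σ))·(Φ'(t)/(1−Φ(t)))·( S_L(t) − S_K(t)·(1−Φ(t))/Φ(t) ). -/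
/-- Capital share in the CES aggregate. -/
noncomputable def SK (σ K L Φ : ℝ) : ℝ :=
  K ^ ((σ - 1) / σ) * Φ ^ (1 / σ)
    / (K ^ ((σ - 1) / σ) * Φ ^ (1 / σ) + L ^ ((σ - 1) / σ) * (1 - Φ) ^ (1 / σ))

/-- Power rule in logarithmic form. -/
lemma HasDerivAt.rpow_const_of_pos {f : ℝ → ℝ} {f' x : ℝ} (p : ℝ) (hf : HasDerivAt f f' x)
    (hx : 0 < f x) : HasDerivAt (fun y => f y ^ p) (f x ^ p * (p * (f' / f x))) x := by
  convert hf.rpow_const (p := p) (Or.inl hx.ne') using 1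
  rw [Real.rpow_sub_one hx.ne']
  ring

/-- Growth decomposition of CES output in capital and in the distribution parameter. -/
lemma hasDerivAt_F {A σ L : ℝ} (hσ0 : 0 < σ) (hσ1 : σ < 1) (hL : 0 < L)
    {K Φ : ℝ → ℝ} {K' Φ' t : ℝ} (hK : HasDerivAt K K' t) (hΦ : HasDerivAt Φ Φ' t)
    (hKpos : 0 < K t) (hΦmem : Φ t ∈ Set.Ioo (0 : ℝ) 1) :
    HasDerivAt (fun s => F A σ (K s) L (Φ s))
      (F A σ (K t) L (Φ t) * (SK σ (K t) L (Φ t) * K' / K t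
          + (1 / (1 - σ)) * (Φ' / (1 - Φ t))
            * ((1 - SK σ (K t) L (Φ t))
                - SK σ (K t) L (Φ t) * (1 - Φ t) / Φ t))) t := by
  obtain ⟨hΦ0, hΦ1⟩ := hΦmem
  have hΦ1' : 0 < 1 - Φ t := sub_pos.2 hΦ1
  have hcap := (hK.rpow_const_of_pos ((σ - 1) / σ) hKpos).fun_mul
    (hΦ.rpow_const_of_pos (1 / σ) hΦ0)
  have hlab := ((hΦ.const_sub 1).rpow_const_of_pos (1 / σ) hΦ1').const_mul (L ^ ((σ - 1) / σ))
  have hpos : 0 < K t ^ ((σ - 1) / σ) * Φ t ^ (1 / σ)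
      + L ^ ((σ - 1) / σ) * (1 - Φ t) ^ (1 / σ) := by positivity
  have hY := ((hcap.fun_add hlab).rpow_const_of_pos (σ / (σ - 1)) hpos).const_mul A
  unfold F SK
  refine hY.congr_deriv ?_
  rw [mul_assoc A]
  congr 2
  generalize K t ^ ((σ - 1) / σ) = k at hpos ⊢
  generalize Φ t ^ (1 / σ) = a at hpos ⊢
  generalize L ^ ((σ - 1) / σ) = l at hpos ⊢
  generalize (1 - Φ t) ^ (1 / σ) = b at hpos ⊢
  have hσ : σ - 1 ≠ 0 := by linarith
  have hneg : 1 / (1 - σ) = -(1 / (σ - 1)) := by rw [← neg_sub σ 1, one_div_neg_eq_neg_one_div]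
  rw [hneg]
  field_simp
  ring

theorem stmt14 (A σ L : ℝ) (hA : 0 < A) (hσ0 : 0 < σ) (hσ1 : σ < 1) (hL : 0 < L)
    (K Φ : ℝ → ℝ) (hKdiff : Differentiable ℝ K) (hΦdiff : Differentiable ℝ Φ)
    (hKpos : ∀ t, 0 < K t) (hΦmem : ∀ t, Φ t ∈ Set.Ioo (0 : ℝ) 1) :
    Differentiable ℝ (fun t => F A σ (K t) L (Φ t))
    ∧ ∀ t : ℝ,
      deriv (fun t' => F A σ (K t') L (Φ t')) t / F A σ (K t) L (Φ t)
        = SK σ (K t) L (Φ t) * deriv K t / K t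
          + (1 / (1 - σ)) * (deriv Φ t / (1 - Φ t))
            * ((1 - SK σ (K t) L (Φ t))
                - SK σ (K t) L (Φ t) * (1 - Φ t) / Φ t) := by
  have hderiv := fun t => hasDerivAt_F (A := A) hσ0 hσ1 hL (hKdiff t).hasDerivAt
    (hΦdiff t).hasDerivAt (hKpos t) (hΦmem t)
  refine ⟨fun t => (hderiv t).differentiableAt, fun t => ?_⟩
  obtain ⟨hΦ0, hΦ1⟩ := hΦmem t
  have hK := hKpos t
  have hΦ1' : 0 < 1 - Φ t := sub_pos.2 hΦ1
  have hF : 0 < F A σ (K t) L (Φ t) := by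
    unfold F
    positivity
  rw [(hderiv t).deriv, mul_div_cancel_left₀ _ hF.ne']
end

section
/- (Scarcity of labor with a fixed factor) For every K > 0, L > 0, M > 0 and Φ ∈ (0,1): G_L(K,L,M;Φ) > G_K(K,L,M;Φ) if and only if K/L > Φ/(1−Φ); in particular the threshold is independent of M and coincides with the threshold of the model without the fixed factor. -/
/-- Fixed-factor (region-1) production function
`G(K,L,M;Φ) = A·(K^((σ−1)/σ)·Φ^(1/σ) + L^((σ−1)/σ)·(1−Φ)^(1/σ))^((σ/(σ−1))·α)·M^(1−α)`. -/
noncomputable def G (A σ α K L M Φ : ℝ) : ℝ :=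
  A * (K ^ ((σ - 1) / σ) * Φ ^ (1 / σ) + L ^ ((σ - 1) / σ) * (1 - Φ) ^ (1 / σ))
      ^ ((σ / (σ - 1)) * α) * M ^ (1 - α)

/-- Return to capital: partial derivative of `G` with respect to `K`. -/
noncomputable def GK (A σ α K L M Φ : ℝ) : ℝ := deriv (fun K' => G A σ α K' L M Φ) K

/-- Wage: partial derivative of `G` with respect to `L`. -/
noncomputable def Gl (A σ α K L M Φ : ℝ) : ℝ := deriv (fun L' => G A σ α K L' M Φ) L

/-- Exchanging capital and labor together with their shares leaves output unchanged. -/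
lemma G_swap (A σ α K L M Φ : ℝ) : G A σ α K L M Φ = G A σ α L K M (1 - Φ) := by
  simp only [G, sub_sub_cancel]
  rw [add_comm]

/-- The return to capital is a positive factor, symmetric in the two inputs,
times `(Φ / K) ^ (1 / σ)`. -/
lemma GK_eq {A σ α K L M Φ : ℝ} (hσ0 : 0 < σ) (hσ1 : σ < 1) (hK : 0 < K) (hL : 0 < L)
    (hΦ0 : 0 < Φ) (hΦ1 : Φ < 1) :
    GK A σ α K L M Φ = A * α *
      (K ^ ((σ - 1) / σ) * Φ ^ (1 / σ) + L ^ ((σ - 1) / σ) * (1 - Φ) ^ (1 / σ))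
        ^ ((σ / (σ - 1)) * α - 1) * M ^ (1 - α) * (Φ / K) ^ (1 / σ) := by
  have hΦ : 0 < 1 - Φ := sub_pos.2 hΦ1
  have hS : 0 < K ^ ((σ - 1) / σ) * Φ ^ (1 / σ) + L ^ ((σ - 1) / σ) * (1 - Φ) ^ (1 / σ) := by
    positivity
  have hderiv := ((((((Real.hasDerivAt_rpow_const (p := (σ - 1) / σ) (Or.inl hK.ne')).mul_const
    (Φ ^ (1 / σ))).add_const (L ^ ((σ - 1) / σ) * (1 - Φ) ^ (1 / σ))).rpow_const
    (p := (σ / (σ - 1)) * α) (Or.inl hS.ne')).const_mul A).mul_const (M ^ (1 - α))).deriv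
  have hexp : (σ - 1) / σ - 1 = -(1 / σ) := by field_simp; ring
  have hcoef : (σ - 1) / σ * (σ / (σ - 1) * α) = α := by
    have : σ - 1 ≠ 0 := (sub_neg.2 hσ1).ne
    field_simp
  have hpow : (Φ / K) ^ (1 / σ) = K ^ (-(1 / σ)) * Φ ^ (1 / σ) := by
    rw [Real.div_rpow hΦ0.le hK.le, Real.rpow_neg hK.le, div_eq_inv_mul]
  unfold GK G
  rw [hderiv, hexp, hpow]
  linear_combination A * K ^ (-(1 / σ)) * Φ ^ (1 / σ) * M ^ (1 - α) *
    (K ^ ((σ - 1) / σ) * Φ ^ (1 / σ) + L ^ ((σ - 1) / σ) * (1 - Φ) ^ (1 / σ))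
      ^ ((σ / (σ - 1)) * α - 1) * hcoef

/-- The wage is the return to capital of the economy with the two inputs exchanged. -/
lemma Gl_eq_GK_swap (A σ α K L M Φ : ℝ) : Gl A σ α K L M Φ = GK A σ α L K M (1 - Φ) := by
  simp only [Gl, GK, G_swap A σ α K _ M Φ]

theorem stmt16 (A σ α K L M Φ : ℝ) (hA : 0 < A) (hσ0 : 0 < σ) (hσ1 : σ < 1)
    (hα0 : 0 < α) (hα1 : α < 1)
    (hK : 0 < K) (hL : 0 < L) (hM : 0 < M) (hΦ0 : 0 < Φ) (hΦ1 : Φ < 1) :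
    Gl A σ α K L M Φ > GK A σ α K L M Φ ↔ K / L > Φ / (1 - Φ) := by
  have hΦ : 0 < 1 - Φ := sub_pos.2 hΦ1
  rw [Gl_eq_GK_swap, GK_eq hσ0 hσ1 hL hK hΦ (sub_lt_self 1 hΦ0), GK_eq hσ0 hσ1 hK hL hΦ0 hΦ1,
    sub_sub_cancel, add_comm (L ^ ((σ - 1) / σ) * (1 - Φ) ^ (1 / σ)), gt_iff_lt, gt_iff_lt,
    mul_lt_mul_iff_right₀ (by positivity),
    Real.rpow_lt_rpow_iff (by positivity) (by positivity) (by positivity),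
    div_lt_div_iff₀ hK hL, div_lt_div_iff₀ hΦ hL, mul_comm (1 - Φ) K]
end

section
/- (Automation and wages with a fixed factor) For every K > 0, L > 0, M > 0 and Φ ∈ (0,1), with k = K/Φ, ℓ = L/(1−Φ) and T = (K^((σ−1)/σ)·Φ^(1/σ) + L^((σ−1)/σ)·(1−Φ)^(1/σ))^(σ/(σ−1)), the logarithmic derivative of the wage G_L with respect to Φ satisfies ∂(log G_L)/∂Φ = ((σ/(σ−1))·α − 1)·(1/σ)·(k^((σ−1)/σ) − ℓ^((σ−1)/σ))·T^((1−σ)/σ) − 1/(σ·(1−Φ)). -/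
/-- Closed form of the wage at interior automation levels. -/
theorem Gl_eq {A σ α K L M Φ : ℝ} (hσ0 : 0 < σ) (hσ1 : σ < 1)
    (hK : 0 < K) (hL : 0 < L) (hΦ0 : 0 < Φ) (hΦ1 : Φ < 1) :
    Gl A σ α K L M Φ = (A * α * M ^ (1 - α) * L ^ ((σ - 1) / σ - 1))
      * ((K ^ ((σ - 1) / σ) * Φ ^ (1 / σ) + L ^ ((σ - 1) / σ) * (1 - Φ) ^ (1 / σ))
          ^ ((σ / (σ - 1)) * α - 1) * (1 - Φ) ^ (1 / σ)) := by
  have hΦ : 0 < 1 - Φ := sub_pos.2 hΦ1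
  have hσ : σ - 1 ≠ 0 := (sub_neg.2 hσ1).ne
  have hX : K ^ ((σ - 1) / σ) * Φ ^ (1 / σ) + L ^ ((σ - 1) / σ) * (1 - Φ) ^ (1 / σ) ≠ 0 := by
    positivity
  have h := (((((Real.hasDerivAt_rpow_const (p := (σ - 1) / σ) (Or.inl hL.ne')).mul_const
    ((1 - Φ) ^ (1 / σ))).const_add (K ^ ((σ - 1) / σ) * Φ ^ (1 / σ))).rpow_const
    (p := (σ / (σ - 1)) * α) (Or.inl hX)).const_mul A).mul_const (M ^ (1 - α))
  refine h.deriv.trans ?_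
  field_simp

/-- Derivative of the inner CES aggregate with respect to the automation level. -/
theorem hasDerivAt_ces {σ K L Φ : ℝ} (hσ0 : 0 < σ)
    (hK : 0 < K) (hL : 0 < L) (hΦ0 : 0 < Φ) (hΦ1 : Φ < 1) :
    HasDerivAt (fun Φ' => K ^ ((σ - 1) / σ) * Φ' ^ (1 / σ)
        + L ^ ((σ - 1) / σ) * (1 - Φ') ^ (1 / σ))
      ((1 / σ) * ((K / Φ) ^ ((σ - 1) / σ) - (L / (1 - Φ)) ^ ((σ - 1) / σ))) Φ := by
  have hΦ : 0 < 1 - Φ := sub_pos.2 hΦ1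
  have hexp : 1 / σ - 1 = -((σ - 1) / σ) := by field_simp; ring
  have h := ((Real.hasDerivAt_rpow_const (p := 1 / σ) (Or.inl hΦ0.ne')).const_mul
    (K ^ ((σ - 1) / σ))).add ((((hasDerivAt_id Φ).const_sub 1).rpow_const
      (p := 1 / σ) (Or.inl hΦ.ne')).const_mul (L ^ ((σ - 1) / σ)))
  refine h.congr_deriv ?_
  rw [hexp, Real.div_rpow hK.le hΦ0.le, Real.div_rpow hL.le hΦ.le, id,
    Real.rpow_neg hΦ0.le, Real.rpow_neg hΦ.le]
  ring

theorem stmt17 (A σ α K L M Φ : ℝ) (hA : 0 < A) (hσ0 : 0 < σ) (hσ1 : σ < 1)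
    (hα0 : 0 < α) (hα1 : α < 1)
    (hK : 0 < K) (hL : 0 < L) (hM : 0 < M) (hΦ0 : 0 < Φ) (hΦ1 : Φ < 1) :
    deriv (fun Φ' => Real.log (Gl A σ α K L M Φ')) Φ
      = ((σ / (σ - 1)) * α - 1) * (1 / σ)
          * ((K / Φ) ^ ((σ - 1) / σ) - (L / (1 - Φ)) ^ ((σ - 1) / σ))
          * ((K ^ ((σ - 1) / σ) * Φ ^ (1 / σ) + L ^ ((σ - 1) / σ) * (1 - Φ) ^ (1 / σ))
              ^ (σ / (σ - 1))) ^ ((1 - σ) / σ)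
        - 1 / (σ * (1 - Φ)) := by
  have hΦ : 0 < 1 - Φ := sub_pos.2 hΦ1
  have hσ : σ - 1 ≠ 0 := (sub_neg.2 hσ1).ne
  have hXpos : ∀ x : ℝ, 0 < x → x < 1 →
      0 < K ^ ((σ - 1) / σ) * x ^ (1 / σ) + L ^ ((σ - 1) / σ) * (1 - x) ^ (1 / σ) := by
    intro x hx0 hx1
    have := sub_pos.2 hx1
    positivity
  have hlog : (fun Φ' => Real.log (Gl A σ α K L M Φ')) =ᶠ[nhds Φ] fun Φ' =>
      Real.log (A * α * M ^ (1 - α) * L ^ ((σ - 1) / σ - 1))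
        + (((σ / (σ - 1)) * α - 1) * Real.log (K ^ ((σ - 1) / σ) * Φ' ^ (1 / σ)
            + L ^ ((σ - 1) / σ) * (1 - Φ') ^ (1 / σ))
          + (1 / σ) * Real.log (1 - Φ')) := by
    filter_upwards [Ioo_mem_nhds hΦ0 hΦ1] with x hx
    have hx' : 0 < 1 - x := sub_pos.2 hx.2
    have hX := hXpos x hx.1 hx.2
    rw [Gl_eq hσ0 hσ1 hK hL hx.1 hx.2, Real.log_mul (by positivity)
      (mul_pos (Real.rpow_pos_of_pos hX _) (Real.rpow_pos_of_pos hx' _)).ne',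
      Real.log_mul (Real.rpow_pos_of_pos hX _).ne' (Real.rpow_pos_of_pos hx' _).ne',
      Real.log_rpow hX, Real.log_rpow hx']
  have hX := hXpos Φ hΦ0 hΦ1
  have h := ((((hasDerivAt_ces hσ0 hK hL hΦ0 hΦ1).log hX.ne').const_mul
    ((σ / (σ - 1)) * α - 1)).add ((((hasDerivAt_id Φ).const_sub 1).log hΦ.ne').const_mul
      (1 / σ))).const_add (Real.log (A * α * M ^ (1 - α) * L ^ ((σ - 1) / σ - 1)))
  have hexp : σ / (σ - 1) * ((1 - σ) / σ) = -1 := by field_simp; ring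
  rw [hlog.deriv_eq]
  refine h.deriv.trans ?_
  rw [← Real.rpow_mul hX.le, hexp, Real.rpow_neg_one, id]
  field_simp
  ring
end
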